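/- Let (Ω, μ) be a probability space, f_{i,j} ∈ L^1(Ω²) for i, j = 1,…,n, and 1 ≤ p < ∞. Then ∫_{Ω^n} ∫_{Ω^n} ( ∑_{i,j} |f_{i,j}(x_i, y_j)|^p )^{1/p} dx dy is equivalent, with constants independent of p and n, to the infimum over all decompositions ⨿_{i,j} f_{i,j} = a + b + c + d of ‖a‖_{L^1(⨿_i Ω × ⨿_j Ω)} + ‖b‖_{L^p(⨿_i Ω × ⨿_j Ω)} + ‖c‖_{L^1(⨿_i Ω, L^p(⨿_j Ω))} + ‖d‖_{L^1(⨿_j Ω, L^p(⨿_i Ω))}. Explicitly: the upper bound holds with constant 1 for every decomposition; and there is an absolute constant C such that if ∫∫ (∑_{i,j} |f_{i,j}(x_i,y_j)|^p)^{1/p} dx dy ≤ 1 then there is a decomposition f_{i,j} = a_{i,j} + b_{i,j} + c_{i,j} + d_{i,j} with ∑_{i,j} ∫_Ω ∫_Ω |a_{i,j}(ξ,υ)| dξ dυ ≤ C, ∑_{i,j} ∫_Ω ∫_Ω |b_{i,j}(ξ,υ)|^p dξ dυ ≤ C^p, ∑_i ∫_Ω ( ∑_j ∫_Ω |c_{i,j}(ξ,υ)|^p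 dυ )^{1/p} dξ ≤ C, and ∑_j ∫_Ω ( ∑_i ∫_Ω |d_{i,j}(ξ,υ)|^p dξ )^{1/p} dυ ≤ C; moreover the decomposition can be so chosen that, for every (i,j), the supports of a_{i,j}, b_{i,j}, c_{i,j}, d_{i,j} are pairwise disjoint. -/

import Mathlib

open MeasureTheory
open scoped ENNReal

universe u

variable {Ω : Type u} [MeasurableSpace Ω]

/-- `‖a‖_{L¹(⨿_i Ω × ⨿_j Ω)}`. -/
noncomputable def normL1L1 (μ : Measure Ω) {n : ℕ} (a : Fin n → Fin n → Ω → Ω → ℝ) :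
    ℝ≥0∞ :=
  ∑ i, ∑ j, ∫⁻ ξ, ∫⁻ υ, ENNReal.ofReal |a i j ξ υ| ∂μ ∂μ

/-- `‖b‖_{L^p(⨿_i Ω × ⨿_j Ω)}`. -/
noncomputable def normLpLp (μ : Measure Ω) (p : ℝ) {n : ℕ}
    (b : Fin n → Fin n → Ω → Ω → ℝ) : ℝ≥0∞ :=
  (∑ i, ∑ j, ∫⁻ ξ, ∫⁻ υ, ENNReal.ofReal (|b i j ξ υ| ^ p) ∂μ ∂μ) ^ (1/p)

/-- `‖c‖_{L¹(⨿_i Ω, L^p(⨿_j Ω))}`. -/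
noncomputable def normL1Lp (μ : Measure Ω) (p : ℝ) {n : ℕ}
    (c : Fin n → Fin n → Ω → Ω → ℝ) : ℝ≥0∞ :=
  ∑ i, ∫⁻ ξ, (∑ j, ∫⁻ υ, ENNReal.ofReal (|c i j ξ υ| ^ p) ∂μ) ^ (1/p) ∂μ

/-- `‖d‖_{L¹(⨿_j Ω, L^p(⨿_i Ω))}`. -/
noncomputable def normL1Lp' (μ : Measure Ω) (p : ℝ) {n : ℕ}
    (d : Fin n → Fin n → Ω → Ω → ℝ) : ℝ≥0∞ :=
  ∑ j, ∫⁻ υ, (∑ i, ∫⁻ ξ, ENNReal.ofReal (|d i j ξ υ| ^ p) ∂μ) ^ (1/p) ∂μ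



/-- Product of functions of two different coordinates. -/
lemma fsd_indep {ι : Type*} [Fintype ι] (μ : Measure Ω) [IsProbabilityMeasure μ] {i j : ι}
    (hij : i ≠ j) {v z : Ω → ℝ≥0∞} (hv : Measurable v) (hz : Measurable z) :
    ∫⁻ x : ι → Ω, v (x i) * z (x j) ∂Measure.pi (fun _ => μ) = (∫⁻ a, v a ∂μ) * ∫⁻ a, z a ∂μ := by
  have h1 : ProbabilityTheory.iIndepFun (fun (k : ι) (x : ι → Ω) => x k)
      (Measure.pi (fun _ : ι => μ)) :=
    ProbabilityTheory.iIndepFun_pi (X := fun _ ω => ω) (fun _ => aemeasurable_id)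
  have h2 := (h1.indepFun hij).comp hv hz
  have h3 := ProbabilityTheory.lintegral_mul_eq_lintegral_mul_lintegral_of_indepFun
    (μ := Measure.pi (fun _ : ι => μ)) (hv.comp (measurable_pi_apply i))
    (hz.comp (measurable_pi_apply j)) h2
  simp only [Pi.mul_apply, Function.comp] at h3
  rw [h3, (measurePreserving_eval (fun _ : ι => μ) i).lintegral_comp hv,
    (measurePreserving_eval (fun _ : ι => μ) j).lintegral_comp hz]

lemma fsd_eval {ι : Type*} [Fintype ι] (μ : Measure Ω) [IsProbabilityMeasure μ] (i : ι)
    {v : Ω → ℝ≥0∞} (hv : Measurable v) :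
    ∫⁻ x : ι → Ω, v (x i) ∂Measure.pi (fun _ => μ) = ∫⁻ a, v a ∂μ :=
  (measurePreserving_eval (fun _ : ι => μ) i).lintegral_comp hv

lemma fsd_cov1 {ι : Type*} [Fintype ι] (μ : Measure Ω) [IsProbabilityMeasure μ] (i : ι)
    {v : Ω → ℝ≥0∞} {z : ι → Ω → ℝ≥0∞} (hv : Measurable v) (hz : ∀ l, Measurable (z l)) :
    ∫⁻ x : ι → Ω, v (x i) * ∑ l, z l (x l) ∂Measure.pi (fun _ => μ)
      ≤ ∫⁻ a, v a * z i a ∂μ + (∫⁻ a, v a ∂μ) * ∑ l, ∫⁻ a, z l a ∂μ := by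
  classical
  simp_rw [Finset.mul_sum]
  rw [lintegral_finsetSum _ (fun l _ => by fun_prop)]
  rw [← Finset.add_sum_erase _ _ (Finset.mem_univ i)]
  rw [fsd_eval μ i (v := fun a => v a * z i a) (hv.mul (hz i))]
  gcongr
  calc _ = ∑ l ∈ Finset.univ.erase i, (∫⁻ a, v a ∂μ) * ∫⁻ a, z l a ∂μ := by
        refine Finset.sum_congr rfl fun l hl => ?_
        exact fsd_indep μ (Finset.ne_of_mem_erase hl).symm hv (hz l)
    _ ≤ _ := Finset.sum_le_sum_of_subset (Finset.erase_subset _ _)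

/-- Small probability of being nonzero and second moment bound imply small mean. -/
lemma fsd_count {X : Type*} [MeasurableSpace X] (P : Measure X)
    (S Q : X → ℝ≥0∞) (hS : Measurable S) (D : ℝ≥0∞) (hD : D ≤ 2)
    (hm : ∫⁻ x, S x ∂P ≠ ⊤)
    (h2 : ∫⁻ x, S x * S x ∂P ≤ (∫⁻ x, S x ∂P) * (D + ∫⁻ x, S x ∂P))
    (hQ : ∀ x, S x ≠ 0 → 1 ≤ Q x) (hQi : ∫⁻ x, Q x ∂P ≤ 1 / 64) :
    ∫⁻ x, S x ∂P ≤ 1 / 4 := by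
  set m := ∫⁻ x, S x ∂P with hmdef
  have hL : (4 * (m + 2)) ≠ ⊤ := by finiteness
  set L := 4 * (m + 2) with hLdef
  have key : L * m ≤ L * L * (1 / 64) + m * (2 + m) := by
    calc L * m = ∫⁻ x, L * S x ∂P := by rw [lintegral_const_mul _ hS]
      _ ≤ ∫⁻ x, (S x * S x + (L * L) * Q x) ∂P := by
          refine lintegral_mono fun x => ?_
          by_cases h0 : S x = 0
          · simp [h0]
          rcases le_total L (S x) with h | h
          · exact (mul_le_mul_left h _).trans le_self_add
          · calc L * S x ≤ L * L * 1 := by rw [mul_one]; gcongr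
              _ ≤ L * L * Q x := by gcongr; exact hQ x h0
              _ ≤ _ := le_add_self
      _ = ∫⁻ x, S x * S x ∂P + (L * L) * ∫⁻ x, Q x ∂P := by
          rw [lintegral_add_left (hS.fun_mul hS), lintegral_const_mul' _ _ (by finiteness)]
      _ ≤ m * (D + m) + L * L * (1 / 64) := by gcongr
      _ ≤ m * (2 + m) + L * L * (1 / 64) := by gcongr
      _ = _ := add_comm _ _
  clear_value m
  lift m to NNReal using hm
  rw [hLdef] at key
  have key' : (4 * (m + 2)) * m ≤ (4 * (m+2)) * (4 * (m+2)) * (1/64) + m * (2 + m) := by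
    have : ((1/64 : NNReal) : ℝ≥0∞) = 1/64 := by
      rw [ENNReal.coe_div (by norm_num)]; simp
    rw [← this] at key
    exact_mod_cast key
  have : m ≤ 1/4 := by
    rw [← NNReal.coe_le_coe] at key' ⊢
    push_cast at key' ⊢
    have := m.coe_nonneg
    nlinarith
  have h4 : ((1/4 : NNReal) : ℝ≥0∞) = 1/4 := by
    rw [ENNReal.coe_div (by norm_num)]; simp
  rw [← h4]
  exact_mod_cast this

lemma fsd_moment {X : Type*} [MeasurableSpace X] (P : Measure X)
    (S : X → ℝ≥0∞) (hS : Measurable S) (D κ : ℝ≥0∞) (p : ℝ) (hp : 1 ≤ p)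
    (hm : ∫⁻ x, S x ∂P ≠ ⊤) (hκ : κ ≠ ⊤)
    (h2 : ∫⁻ x, S x * S x ∂P ≤ (∫⁻ x, S x ∂P) * (D + ∫⁻ x, S x ∂P))
    (h1 : ∫⁻ x, (S x) ^ (1/p) ∂P ≤ κ) :
    ∫⁻ x, S x ∂P ≤ max D ((8 * κ) ^ p) := by
  set m := ∫⁻ x, S x ∂P with hmdef
  have hp0 : 0 < p := by linarith
  rcases le_total m D with hD | hD
  · exact le_max_of_le_left hD
  refine le_max_of_le_right ?_
  by_cases hm0 : m = 0
  · simp [hm0]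
  have hr1 : 1 / p ≤ 1 := by rw [div_le_one hp0]; exact hp
  have hr0 : 0 < 1 / p := by positivity
  set r := 1 / p with hr
  set L := 4 * m with hLdef
  have hL : L ≠ ⊤ := by finiteness
  have hL0 : L ≠ 0 := by simp [hLdef, hm0]
  have key : L * m ≤ L * L ^ (1 - r) * κ + m * (m + m) := by
    calc L * m = ∫⁻ x, L * S x ∂P := by rw [lintegral_const_mul _ hS]
      _ ≤ ∫⁻ x, (S x * S x + (L * L ^ (1 - r)) * S x ^ r) ∂P := by
          refine lintegral_mono fun x => ?_
          rcases le_total L (S x) with h | h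
          · exact (mul_le_mul_left h _).trans le_self_add
          · calc L * S x = L * (S x ^ (1 - r) * S x ^ r) := by
                  rw [← ENNReal.rpow_add_of_nonneg _ _ (by linarith) hr0.le]; simp
              _ ≤ L * (L ^ (1 - r) * S x ^ r) := by
                  gcongr
              _ = L * L ^ (1 - r) * S x ^ r := by ring
              _ ≤ _ := le_add_self
      _ = ∫⁻ x, S x * S x ∂P + (L * L ^ (1 - r)) * ∫⁻ x, S x ^ r ∂P := by
          rw [lintegral_add_left (hS.fun_mul hS), lintegral_const_mul' _ _ (by
            have : 0 ≤ 1 - r := by linarith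
            finiteness)]
      _ ≤ m * (D + m) + L * L ^ (1 - r) * κ := by gcongr
      _ ≤ m * (m + m) + L * L ^ (1 - r) * κ := by gcongr
      _ = _ := add_comm _ _
  have h8 : L ^ r ≤ 8 * κ := by
    have e : L ^ (1 - r) = L / L ^ r := by
      rw [ENNReal.rpow_sub _ _ hL0 hL, ENNReal.rpow_one]
    rw [e] at key
    have hLr : L ^ r ≠ ⊤ := by finiteness
    have hLr0 : L ^ r ≠ 0 := by
      simp [ENNReal.rpow_eq_zero_iff, hL0, hL]
    generalize L ^ r = y at key hLr hLr0
    clear_value m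
    rw [hLdef] at key
    lift m to NNReal using hm
    lift κ to NNReal using hκ
    lift y to NNReal using hLr
    have hy : y ≠ 0 := by exact_mod_cast hLr0
    have hmm : m ≠ 0 := by exact_mod_cast hm0
    rw [show (4 * (m : ℝ≥0∞)) / y = ((4 * m / y : NNReal) : ℝ≥0∞) by
      rw [ENNReal.coe_div hy]; push_cast; rfl] at key
    have key' : 4 * m * m ≤ 4 * m * (4 * m / y) * κ + m * (m + m) := by exact_mod_cast key
    have : y ≤ 8 * κ := by
      rw [← NNReal.coe_le_coe] at key' ⊢
      push_cast at key' ⊢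
      have hy' : 0 < (y : ℝ) := by positivity
      have hm' : 0 < (m : ℝ) := by positivity
      have e2 : 4 * (m : ℝ) * (4 * m / y) * κ = 16 * m ^ 2 * κ / y := by field_simp; ring
      rw [e2] at key'
      have : 2 * (m : ℝ) ^ 2 ≤ 16 * m ^ 2 * κ / y := by nlinarith
      rw [le_div_iff₀ hy'] at this
      have hm2 : 0 < 2 * (m : ℝ) ^ 2 := by positivity
      nlinarith
    exact_mod_cast this
  calc m ≤ L := by rw [hLdef]; exact le_mul_of_one_le_left zero_le (by norm_num)
    _ = (L ^ r) ^ p := by rw [← ENNReal.rpow_mul, hr, one_div_mul_cancel hp0.ne', ENNReal.rpow_one]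
    _ ≤ _ := by gcongr

lemma fsd_weight {X : Type*} [MeasurableSpace X] (P : Measure X) [IsProbabilityMeasure P]
    {ι : Type*} [Fintype ι] (U : ι → Set X) (hU : ∀ i, MeasurableSet (U i))
    (g : ι → X → ℝ≥0∞) (hg : ∀ i, Measurable (g i)) (F : X → ℝ≥0∞) (κ D : ℝ≥0∞)
    (hκ0 : κ ≠ 0) (hκ : κ ≠ ⊤) (hgF : ∀ i x, g i x ≤ F x)
    (hUg : ∀ i, ∀ x ∈ U i, 64 * κ ≤ g i x) (hF : ∫⁻ x, F x ∂P ≤ κ)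
    (hD : D ≤ 3 / 2)
    (hc1 : ∀ i, ∫⁻ x, (U i).indicator 1 x * ∑ j, (U j).indicator 1 x ∂P ≤
      (∫⁻ x, (U i).indicator 1 x ∂P) * (D + ∫⁻ x, ∑ j, (U j).indicator (1 : X → ℝ≥0∞) x ∂P))
    (hc2 : ∀ i, ∫⁻ x, (U i).indicator (g i) x * ∑ j, (U j).indicator 1 x ∂P ≤
      (∫⁻ x, (U i).indicator (g i) x ∂P) *
        (D + ∫⁻ x, ∑ j, (U j).indicator (1 : X → ℝ≥0∞) x ∂P)) :
    ∫⁻ x, ∑ j, (U j).indicator (1 : X → ℝ≥0∞) x ∂P ≤ 1 / 4 ∧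
      ∑ i, ∫⁻ x, (U i).indicator (g i) x ∂P ≤ 4 * κ := by
  classical
  have hI : ∀ j, Measurable ((U j).indicator (1 : X → ℝ≥0∞)) :=
    fun j => measurable_one.indicator (hU j)
  have hW : ∀ j, Measurable ((U j).indicator (g j)) := fun j => (hg j).indicator (hU j)
  have hN : Measurable (fun x => ∑ j, (U j).indicator (1 : X → ℝ≥0∞) x) :=
    Finset.measurable_fun_sum _ fun j _ => hI j
  have hm : ∫⁻ x, ∑ j, (U j).indicator (1 : X → ℝ≥0∞) x ∂P ≠ ⊤ := by
    rw [lintegral_finsetSum _ fun j _ => hI j]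
    refine ENNReal.sum_ne_top.2 fun j _ => ?_
    rw [lintegral_indicator_one (hU j)]
    finiteness
  have hKz : 64 * κ ≠ 0 := by simp [hκ0]
  have hKt : 64 * κ ≠ ⊤ := by finiteness
  have hfirst : ∫⁻ x, ∑ j, (U j).indicator (1 : X → ℝ≥0∞) x ∂P ≤ 1 / 4 := by
    refine fsd_count P _ (fun x => F x * (64 * κ)⁻¹) hN D (hD.trans ?_) hm ?_ ?_ ?_
    · refine ENNReal.div_le_of_le_mul ?_; norm_num
    · simp_rw [Finset.sum_mul]
      rw [lintegral_finsetSum _ fun j _ => (hI j).fun_mul hN, lintegral_finsetSum _ fun j _ => hI j,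
        Finset.sum_mul]
      refine Finset.sum_le_sum fun i _ => ?_
      rw [← lintegral_finsetSum _ fun j _ => hI j]
      exact hc1 i
    · intro x hx
      obtain ⟨i, -, hi⟩ := Finset.exists_ne_zero_of_sum_ne_zero hx
      have hi' : x ∈ U i := Set.mem_of_indicator_ne_zero hi
      calc 1 = 64 * κ * (64 * κ)⁻¹ := (ENNReal.mul_inv_cancel hKz hKt).symm
        _ ≤ _ := by gcongr; exact (hUg i x hi').trans (hgF i x)
    · rw [lintegral_mul_const' _ _ (ENNReal.inv_ne_top.2 hKz)]
      calc _ ≤ κ * (64 * κ)⁻¹ := by gcongr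
        _ = 1 / 64 := by
          rw [ENNReal.mul_inv (by simp) (by simp), mul_left_comm, ENNReal.mul_inv_cancel hκ0 hκ]
          simp
  refine ⟨hfirst, ?_⟩
  have hWt : ∀ i, ∫⁻ x, (U i).indicator (g i) x ∂P ≤ κ := fun i =>
    (lintegral_mono fun x => (Set.indicator_le_self _ _ _).trans (hgF i x)).trans hF
  have hwt : ∑ i, ∫⁻ x, (U i).indicator (g i) x ∂P ≠ ⊤ :=
    ENNReal.sum_ne_top.2 fun i _ => ((hWt i).trans_lt hκ.lt_top).ne
  have key : 2 * ∑ i, ∫⁻ x, (U i).indicator (g i) x ∂P ≤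
      (∑ i, ∫⁻ x, (U i).indicator (g i) x ∂P) * (3/2 + 1/4) + κ := by
    calc _ = ∫⁻ x, 2 * ∑ i, (U i).indicator (g i) x ∂P := by
          rw [lintegral_const_mul _ (Finset.measurable_fun_sum _ fun j _ => hW j),
            lintegral_finsetSum _ fun j _ => hW j]
      _ ≤ ∫⁻ x, ((∑ i, (U i).indicator (g i) x * ∑ j, (U j).indicator 1 x) + F x) ∂P := by
          refine lintegral_mono fun x => ?_
          rw [← Finset.sum_mul]
          by_cases h : ∃ i, x ∈ U i
          · obtain ⟨i, hi⟩ := h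
            by_cases h' : ∃ k, k ≠ i ∧ x ∈ U k
            · obtain ⟨k, hki, hk⟩ := h'
              have : (2 : ℝ≥0∞) ≤ ∑ j, (U j).indicator 1 x := by
                calc (2 : ℝ≥0∞) = ∑ j ∈ {k, i}, (U j).indicator 1 x := by
                      rw [Finset.sum_pair hki]; simp [hi, hk, one_add_one_eq_two]
                  _ ≤ _ := Finset.sum_le_sum_of_subset (Finset.subset_univ _)
              rw [mul_comm]
              exact (mul_le_mul_right this _).trans le_self_add
            · push Not at h'
              have e1 : ∑ i, (U i).indicator (g i) x = g i x := by
                rw [Finset.sum_eq_single i]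
                · simp [hi]
                · intro k _ hk; simp [h' k hk]
                · simp
              have e2 : ∑ i, (U i).indicator (1 : X → ℝ≥0∞) x = 1 := by
                rw [Finset.sum_eq_single i]
                · simp [hi]
                · intro k _ hk; simp [h' k hk]
                · simp
              rw [e1, e2, mul_one, two_mul]
              gcongr
              exact hgF i x
          · push Not at h
            simp [h]
      _ = (∑ i, ∫⁻ x, (U i).indicator (g i) x * ∑ j, (U j).indicator 1 x ∂P) +
            ∫⁻ x, F x ∂P := by
          rw [lintegral_add_left (Finset.measurable_fun_sum _ fun j _ => (hW j).fun_mul hN),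
            lintegral_finsetSum _ fun j _ => (hW j).fun_mul hN]
      _ ≤ (∑ i, (∫⁻ x, (U i).indicator (g i) x ∂P) * (3/2 + 1/4)) + κ := by
          gcongr with i
          refine (hc2 i).trans ?_
          gcongr
      _ = _ := by rw [Finset.sum_mul]
  generalize (∑ i, ∫⁻ x, (U i).indicator (g i) x ∂P) = w at key hwt
  lift w to NNReal using hwt
  lift κ to NNReal using hκ
  have e : (3/2 + 1/4 : ℝ≥0∞) = ((3/2 + 1/4 : NNReal) : ℝ≥0∞) := by
    rw [ENNReal.coe_add, ENNReal.coe_div (by norm_num), ENNReal.coe_div (by norm_num)]; simp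
  rw [e] at key
  have key' : 2 * w ≤ w * (3/2 + 1/4) + κ := by exact_mod_cast key
  have : w ≤ 4 * κ := by
    rw [← NNReal.coe_le_coe] at key' ⊢
    push_cast at key' ⊢
    linarith
  exact_mod_cast this


lemma fsd_one_weight {ι : Type*} [Fintype ι] (μ : Measure Ω) [IsProbabilityMeasure μ]
    (G : ι → Ω → ℝ≥0∞) (hG : ∀ i, Measurable (G i)) (F : (ι → Ω) → ℝ≥0∞) (κ : ℝ≥0∞)
    (hκ0 : κ ≠ 0) (hκ : κ ≠ ⊤) (hGF : ∀ i x, G i (x i) ≤ F x)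
    (hF : ∫⁻ x, F x ∂Measure.pi (fun _ => μ) ≤ κ) :
    ∑ i, ∫⁻ ξ, {ξ | 64 * κ < G i ξ}.indicator (1 : Ω → ℝ≥0∞) ξ ∂μ ≤ 1 / 4 ∧
    ∑ i, ∫⁻ ξ, {ξ | 64 * κ < G i ξ}.indicator (G i) ξ ∂μ ≤ 4 * κ := by
  have hA : ∀ i, MeasurableSet {ξ | 64 * κ < G i ξ} := fun i =>
    measurableSet_lt measurable_const (hG i)
  have h1 : ∀ i, Measurable ({ξ | 64 * κ < G i ξ}.indicator (1 : Ω → ℝ≥0∞)) := fun i =>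
    measurable_one.indicator (hA i)
  have h2 : ∀ i, Measurable ({ξ | 64 * κ < G i ξ}.indicator (G i)) := fun i =>
    (hG i).indicator (hA i)
  have e1 : ∀ i (x : ι → Ω), {x : ι → Ω | 64 * κ < G i (x i)}.indicator (1 : (ι → Ω) → ℝ≥0∞) x
      = {ξ | 64 * κ < G i ξ}.indicator (1 : Ω → ℝ≥0∞) (x i) := fun i x => rfl
  have e2 : ∀ i (x : ι → Ω), {x : ι → Ω | 64 * κ < G i (x i)}.indicator (fun x => G i (x i)) x
      = {ξ | 64 * κ < G i ξ}.indicator (G i) (x i) := fun i x => rfl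
  have e3 : ∫⁻ x : ι → Ω, ∑ i, {ξ | 64 * κ < G i ξ}.indicator (1 : Ω → ℝ≥0∞) (x i)
      ∂Measure.pi (fun _ => μ) = ∑ i, ∫⁻ ξ, {ξ | 64 * κ < G i ξ}.indicator (1 : Ω → ℝ≥0∞) ξ ∂μ := by
    rw [lintegral_finsetSum _ fun i _ => by fun_prop]
    exact Finset.sum_congr rfl fun i _ => fsd_eval μ i (h1 i)
  have hcov : ∀ i (v : Ω → ℝ≥0∞), Measurable v →
      ∫⁻ x : ι → Ω, v (x i) * ∑ j, {ξ | 64 * κ < G j ξ}.indicator (1 : Ω → ℝ≥0∞) (x j)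
        ∂Measure.pi (fun _ => μ) ≤ (∫⁻ ξ, v ξ ∂μ) *
        (1 + ∑ i, ∫⁻ ξ, {ξ | 64 * κ < G i ξ}.indicator (1 : Ω → ℝ≥0∞) ξ ∂μ) := by
    intro i v hv
    refine (fsd_cov1 μ i hv h1).trans ?_
    rw [mul_add, mul_one]
    gcongr with ξ
    exact mul_le_of_le_one_right zero_le (Set.indicator_le_self _ _ _)
  have := fsd_weight (Measure.pi (fun _ : ι => μ)) (fun i => {x | 64 * κ < G i (x i)})
    (fun i => (measurable_pi_apply (X := fun _ : ι => Ω) i) (hA i)) (fun i x => G i (x i))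
    (fun i => (hG i).comp (measurable_pi_apply i)) F κ 1 hκ0 hκ hGF (fun i x hx => le_of_lt hx) hF
    (by rw [ENNReal.le_div_iff_mul_le (by simp) (by simp)]; norm_num)
    (fun i => by
      simp_rw [e1]
      rw [e3, fsd_eval μ i (h1 i)]
      exact hcov i _ (h1 i))
    (fun i => by
      simp_rw [e1, e2]
      rw [e3, fsd_eval μ i (h2 i)]
      exact hcov i _ (h2 i))
  simp_rw [e1, e2, e3] at this
  refine ⟨this.1, ?_⟩
  convert this.2 using 2 with i
  rw [fsd_eval μ i (h2 i)]

lemma fsd_one_moment {ι : Type*} [Fintype ι] (μ : Measure Ω) [IsProbabilityMeasure μ]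
    (G : ι → Ω → ℝ≥0∞) (hG : ∀ i, Measurable (G i)) (κ : ℝ≥0∞) (p : ℝ) (hp : 1 ≤ p)
    (hκ : κ ≠ ⊤)
    (hF : ∫⁻ x : ι → Ω, (∑ i, G i (x i) ^ p) ^ (1/p) ∂Measure.pi (fun _ => μ) ≤ κ) :
    ∑ i, ∫⁻ ξ, {ξ | G i ξ ≤ 64 * κ}.indicator (fun ξ => G i ξ ^ p) ξ ∂μ ≤ (64 * κ) ^ p := by
  have hp0 : 0 < p := by linarith
  set H : ι → Ω → ℝ≥0∞ := fun i => {ξ | G i ξ ≤ 64 * κ}.indicator (fun ξ => G i ξ ^ p) with hH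
  have hHm : ∀ i, Measurable (H i) := fun i =>
    ((hG i).pow_const p).indicator (measurableSet_le (hG i) measurable_const)
  have hHb : ∀ i ξ, H i ξ ≤ (64 * κ) ^ p := by
    intro i ξ
    refine Set.indicator_le' (s := {ξ | G i ξ ≤ 64 * κ}) (f := fun ξ => G i ξ ^ p)
      (g := fun _ => (64 * κ) ^ p) ?_ ?_ ξ
    · intro a ha
      exact ENNReal.rpow_le_rpow ha hp0.le
    · intro a _; exact zero_le
  have e3 : ∫⁻ x : ι → Ω, ∑ i, H i (x i) ∂Measure.pi (fun _ => μ) = ∑ i, ∫⁻ ξ, H i ξ ∂μ := by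
    rw [lintegral_finsetSum _ fun i _ => by fun_prop]
    exact Finset.sum_congr rfl fun i _ => fsd_eval μ i (hHm i)
  have hfin : ∑ i, ∫⁻ ξ, H i ξ ∂μ ≠ ⊤ := by
    refine ENNReal.sum_ne_top.2 fun i _ => ?_
    refine ((lintegral_mono (hHb i)).trans_lt ?_).ne
    simp only [lintegral_const, measure_univ, mul_one]
    exact ENNReal.rpow_lt_top_of_nonneg hp0.le (by finiteness)
  have := fsd_moment (Measure.pi (fun _ : ι => μ)) (fun x => ∑ i, H i (x i))
    (Finset.measurable_fun_sum _ fun i _ => (hHm i).comp (measurable_pi_apply i))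
    ((64 * κ) ^ p) κ p hp (by rw [e3]; exact hfin) hκ
    (by
      rw [e3, Finset.sum_mul]
      simp_rw [Finset.sum_mul]
      rw [lintegral_finsetSum _ fun i _ => by fun_prop]
      refine Finset.sum_le_sum fun i _ => ?_
      refine (fsd_cov1 μ i (hHm i) hHm).trans ?_
      rw [mul_add, ← lintegral_mul_const ((64 * κ) ^ p) (hHm i)]
      gcongr
      exact hHb i _)
    (by
      refine (lintegral_mono fun x => ?_).trans hF
      gcongr with i
      exact Set.indicator_le_self _ (fun ξ => G i ξ ^ p) _)
  rw [e3] at this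
  refine this.trans (max_le le_rfl ?_)
  gcongr
  norm_num

lemma fsd_eval2 {ι : Type*} [Fintype ι] (μ : Measure Ω) [IsProbabilityMeasure μ] (i j : ι)
    {V : Ω × Ω → ℝ≥0∞} (hV : Measurable V) :
    ∫⁻ w : (ι → Ω) × (ι → Ω), V (w.1 i, w.2 j)
      ∂((Measure.pi (fun _ => μ)).prod (Measure.pi (fun _ => μ))) = ∫⁻ q, V q ∂(μ.prod μ) :=
  ((measurePreserving_eval (fun _ : ι => μ) i).prod
    (measurePreserving_eval (fun _ : ι => μ) j)).lintegral_comp hV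

lemma fsd_cov2 {ι : Type*} [Fintype ι] (μ : Measure Ω) [IsProbabilityMeasure μ] (i j : ι)
    {V : Ω × Ω → ℝ≥0∞} {Z : ι → ι → Ω × Ω → ℝ≥0∞} (hV : Measurable V)
    (hZ : ∀ k l, Measurable (Z k l)) (D₀ R : ℝ≥0∞) (h0 : ∀ q, Z i j q ≤ D₀)
    (hR : ∀ ξ, ∑ l, ∫⁻ υ, Z i l (ξ, υ) ∂μ ≤ R) (hC : ∀ υ, ∑ k, ∫⁻ ξ, Z k j (ξ, υ) ∂μ ≤ R) :
    ∫⁻ w : (ι → Ω) × (ι → Ω), V (w.1 i, w.2 j) * ∑ k, ∑ l, Z k l (w.1 k, w.2 l)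
      ∂((Measure.pi (fun _ => μ)).prod (Measure.pi (fun _ => μ))) ≤
    (∫⁻ q, V q ∂(μ.prod μ)) * (D₀ + R + R + ∑ k, ∑ l, ∫⁻ q, Z k l q ∂(μ.prod μ)) := by
  have mV : ∀ ξ, Measurable (fun υ => V (ξ, υ)) := fun ξ => by fun_prop
  have mV' : ∀ υ, Measurable (fun ξ => V (ξ, υ)) := fun ξ => by fun_prop
  have mI : Measurable (fun ξ => ∫⁻ υ, V (ξ, υ) ∂μ) := hV.lintegral_prod_right'
  have mRow : ∀ k, Measurable (fun ξ => ∑ l, ∫⁻ υ, Z k l (ξ, υ) ∂μ) := fun k =>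
    Finset.measurable_fun_sum _ fun l _ => (hZ k l).lintegral_prod_right'
  rw [lintegral_prod _ (by fun_prop)]
  have step1 : ∀ x : ι → Ω, ∫⁻ y : ι → Ω, V (x i, y j) * ∑ k, ∑ l, Z k l (x k, y l)
      ∂Measure.pi (fun _ => μ) ≤
      ∫⁻ υ, V (x i, υ) * ∑ k, Z k j (x k, υ) ∂μ +
      (∫⁻ υ, V (x i, υ) ∂μ) * ∑ k, ∑ l, ∫⁻ υ, Z k l (x k, υ) ∂μ := by
    intro x
    have := fsd_cov1 μ j (v := fun υ => V (x i, υ)) (z := fun l υ => ∑ k, Z k l (x k, υ))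
      (by fun_prop) (fun l => by fun_prop)
    calc _ = _ := by
          refine lintegral_congr fun y => ?_
          rw [Finset.sum_comm]
      _ ≤ _ := this
      _ = _ := by
          congr 2
          rw [Finset.sum_comm]
          refine Finset.sum_congr rfl fun l _ => ?_
          rw [lintegral_finsetSum _ fun k _ => by fun_prop]
  refine (lintegral_mono step1).trans ?_
  have m1 : Measurable (fun w : (ι → Ω) × Ω => V (w.1 i, w.2) * ∑ k, Z k j (w.1 k, w.2)) := by
    fun_prop
  rw [lintegral_add_left m1.lintegral_prod_right']
  have A : ∫⁻ x : ι → Ω, ∫⁻ υ, V (x i, υ) * ∑ k, Z k j (x k, υ) ∂μ ∂Measure.pi (fun _ => μ) ≤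
      (∫⁻ q, V q ∂(μ.prod μ)) * (D₀ + R) := by
    rw [lintegral_lintegral_swap (f := fun (x : ι → Ω) υ => V (x i, υ) * ∑ k, Z k j (x k, υ))
      m1.aemeasurable]
    rw [lintegral_prod_symm _ hV.aemeasurable, ← lintegral_mul_const _ hV.lintegral_prod_left']
    refine lintegral_mono fun υ => ?_
    refine (fsd_cov1 μ i (v := fun ξ => V (ξ, υ)) (z := fun k ξ => Z k j (ξ, υ))
      (by fun_prop) (fun l => by fun_prop)).trans ?_
    rw [mul_add, ← lintegral_mul_const D₀ (mV' υ)]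
    gcongr with ξ
    · exact h0 _
    · exact hC υ
  have B : ∫⁻ x : ι → Ω, (∫⁻ υ, V (x i, υ) ∂μ) * ∑ k, ∑ l, ∫⁻ υ, Z k l (x k, υ) ∂μ
        ∂Measure.pi (fun _ => μ) ≤
      (∫⁻ q, V q ∂(μ.prod μ)) * (R + ∑ k, ∑ l, ∫⁻ q, Z k l q ∂(μ.prod μ)) := by
    refine (fsd_cov1 μ i mI mRow).trans ?_
    rw [lintegral_prod _ hV.aemeasurable, mul_add, ← lintegral_mul_const R mI]
    gcongr with ξ k
    · exact hR ξ
    · rw [lintegral_finsetSum _ fun l _ => (hZ k l).lintegral_prod_right']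
      refine Finset.sum_le_sum fun l _ => ?_
      rw [lintegral_prod _ (hZ k l).aemeasurable]
  refine (add_le_add A B).trans (le_of_eq ?_)
  ring

lemma fsd_two_weight {ι : Type*} [Fintype ι] (μ : Measure Ω) [IsProbabilityMeasure μ]
    (g : ι → ι → Ω × Ω → ℝ≥0∞) (hg : ∀ i j, Measurable (g i j))
    (U : ι → ι → Set (Ω × Ω)) (hU : ∀ i j, MeasurableSet (U i j))
    (F : (ι → Ω) × (ι → Ω) → ℝ≥0∞) (κ : ℝ≥0∞)
    (hκ0 : κ ≠ 0) (hκ : κ ≠ ⊤) (hGF : ∀ i j w, g i j (w.1 i, w.2 j) ≤ F w)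
    (hUg : ∀ i j, ∀ q ∈ U i j, 64 * κ ≤ g i j q)
    (hF : ∫⁻ w, F w ∂((Measure.pi (fun _ => μ)).prod (Measure.pi (fun _ => μ))) ≤ κ)
    (hR : ∀ i ξ, ∑ l, ∫⁻ υ, (U i l).indicator (1 : Ω × Ω → ℝ≥0∞) (ξ, υ) ∂μ ≤ 1 / 4)
    (hC : ∀ j υ, ∑ k, ∫⁻ ξ, (U k j).indicator (1 : Ω × Ω → ℝ≥0∞) (ξ, υ) ∂μ ≤ 1 / 4) :
    ∑ i, ∑ j, ∫⁻ q, (U i j).indicator (g i j) q ∂(μ.prod μ) ≤ 4 * κ := by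
  have h1 : ∀ i j, Measurable ((U i j).indicator (1 : Ω × Ω → ℝ≥0∞)) := fun i j =>
    measurable_one.indicator (hU i j)
  have h2 : ∀ i j, Measurable ((U i j).indicator (g i j)) := fun i j =>
    (hg i j).indicator (hU i j)
  have mpr : ∀ i j, Measurable (fun w : (ι → Ω) × (ι → Ω) => (w.1 i, w.2 j)) := fun i j => by
    fun_prop
  set P := (Measure.pi (fun _ : ι => μ)).prod (Measure.pi (fun _ : ι => μ)) with hP
  have e1 : ∀ (α : ι × ι) (w : (ι → Ω) × (ι → Ω)),
      {w : (ι → Ω) × (ι → Ω) | (w.1 α.1, w.2 α.2) ∈ U α.1 α.2}.indicator (1 : (ι → Ω) × (ι → Ω) → ℝ≥0∞) w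
      = (U α.1 α.2).indicator (1 : Ω × Ω → ℝ≥0∞) (w.1 α.1, w.2 α.2) := fun i x => rfl
  have e2 : ∀ (α : ι × ι) (w : (ι → Ω) × (ι → Ω)),
      {w : (ι → Ω) × (ι → Ω) | (w.1 α.1, w.2 α.2) ∈ U α.1 α.2}.indicator
        (fun w => g α.1 α.2 (w.1 α.1, w.2 α.2)) w
      = (U α.1 α.2).indicator (g α.1 α.2) (w.1 α.1, w.2 α.2) := fun i x => rfl
  have e3 : ∫⁻ w, ∑ α : ι × ι, (U α.1 α.2).indicator (1 : Ω × Ω → ℝ≥0∞) (w.1 α.1, w.2 α.2) ∂P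
      = ∑ k, ∑ l, ∫⁻ q, (U k l).indicator (1 : Ω × Ω → ℝ≥0∞) q ∂(μ.prod μ) := by
    rw [lintegral_finsetSum _ fun α _ => by fun_prop, Fintype.sum_prod_type]
    exact Finset.sum_congr rfl fun i _ => Finset.sum_congr rfl fun j _ => fsd_eval2 μ i j (h1 i j)
  have hcov : ∀ (α : ι × ι) (v : Ω × Ω → ℝ≥0∞), Measurable v →
      ∫⁻ w, v (w.1 α.1, w.2 α.2) *
        ∑ α : ι × ι, (U α.1 α.2).indicator (1 : Ω × Ω → ℝ≥0∞) (w.1 α.1, w.2 α.2) ∂P ≤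
      (∫⁻ q, v q ∂(μ.prod μ)) *
        (3 / 2 + ∑ k, ∑ l, ∫⁻ q, (U k l).indicator (1 : Ω × Ω → ℝ≥0∞) q ∂(μ.prod μ)) := by
    intro α v hv
    simp_rw [Fintype.sum_prod_type]
    refine (fsd_cov2 μ α.1 α.2 hv h1 1 (1/4) (fun q => Set.indicator_le_self _ _ _)
      (hR α.1) (hC α.2)).trans (le_of_eq ?_)
    congr 2
    have a1 : ((3/2 : NNReal) : ℝ≥0∞) = 3/2 := by
      rw [ENNReal.coe_div (by norm_num)]; simp
    have a2 : ((1/4 : NNReal) : ℝ≥0∞) = 1/4 := by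
      rw [ENNReal.coe_div (by norm_num)]; simp
    rw [← a1, ← a2]
    norm_cast
    rw [← NNReal.coe_inj]; push_cast; norm_num
  have := fsd_weight P (fun α : ι × ι => {w | (w.1 α.1, w.2 α.2) ∈ U α.1 α.2})
    (fun α => mpr α.1 α.2 (hU α.1 α.2)) (fun α w => g α.1 α.2 (w.1 α.1, w.2 α.2))
    (fun α => (hg α.1 α.2).comp (mpr α.1 α.2)) F κ (3/2) hκ0 hκ (fun α w => hGF α.1 α.2 w)
    (fun α w hw => hUg α.1 α.2 _ hw) hF le_rfl
    (fun α => by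
      simp_rw [e1]
      rw [e3, fsd_eval2 μ α.1 α.2 (h1 α.1 α.2)]
      exact hcov α _ (h1 α.1 α.2))
    (fun α => by
      simp_rw [e1, e2]
      rw [e3, fsd_eval2 μ α.1 α.2 (h2 α.1 α.2)]
      exact hcov α _ (h2 α.1 α.2))
  simp_rw [e1, e2, e3] at this
  have h := this.2
  rw [Fintype.sum_prod_type] at h
  convert h using 4 with i _ j
  rw [fsd_eval2 μ i j (h2 i j)]

lemma fsd_two_moment {ι : Type*} [Fintype ι] (μ : Measure Ω) [IsProbabilityMeasure μ]
    (H : ι → ι → Ω × Ω → ℝ≥0∞) (hH : ∀ i j, Measurable (H i j)) (κ T : ℝ≥0∞) (p : ℝ) (hp : 1 ≤ p)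
    (hκ : κ ≠ ⊤) (hT : T ≠ ⊤) (hHb : ∀ i j q, H i j q ≤ T)
    (hR : ∀ i ξ, ∑ l, ∫⁻ υ, H i l (ξ, υ) ∂μ ≤ T)
    (hC : ∀ j υ, ∑ k, ∫⁻ ξ, H k j (ξ, υ) ∂μ ≤ T)
    (hF : ∫⁻ w : (ι → Ω) × (ι → Ω), (∑ i, ∑ j, H i j (w.1 i, w.2 j)) ^ (1/p)
      ∂((Measure.pi (fun _ => μ)).prod (Measure.pi (fun _ => μ))) ≤ κ) :
    ∑ i, ∑ j, ∫⁻ q, H i j q ∂(μ.prod μ) ≤ max (T + T + T) ((8 * κ) ^ p) := by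
  set P := (Measure.pi (fun _ : ι => μ)).prod (Measure.pi (fun _ : ι => μ)) with hP
  have mH : ∀ i j, Measurable (fun w : (ι → Ω) × (ι → Ω) => H i j (w.1 i, w.2 j)) := fun i j => by
    fun_prop
  have mH2 : ∀ i, Measurable (fun w : (ι → Ω) × (ι → Ω) => ∑ j, H i j (w.1 i, w.2 j)) :=
    fun i => by fun_prop
  have e3 : ∫⁻ w, ∑ i, ∑ j, H i j (w.1 i, w.2 j) ∂P = ∑ k, ∑ l, ∫⁻ q, H k l q ∂(μ.prod μ) := by
    rw [lintegral_finsetSum _ fun i _ => mH2 i]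
    refine Finset.sum_congr rfl fun i _ => ?_
    rw [lintegral_finsetSum _ fun j _ => mH i j]
    exact Finset.sum_congr rfl fun j _ => fsd_eval2 μ i j (hH i j)
  have hfin : ∑ k, ∑ l, ∫⁻ q, H k l q ∂(μ.prod μ) ≠ ⊤ := by
    refine ENNReal.sum_ne_top.2 fun i _ => ENNReal.sum_ne_top.2 fun j _ => ?_
    refine ((lintegral_mono (hHb i j)).trans_lt ?_).ne
    simp only [lintegral_const, measure_univ, mul_one]
    exact hT.lt_top
  rw [← e3]
  refine fsd_moment P _ (by fun_prop) _ κ p hp (by rw [e3]; exact hfin) hκ ?_ hF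
  rw [e3, Finset.sum_mul]
  simp_rw [Finset.sum_mul]
  rw [lintegral_finsetSum _ fun i _ => by fun_prop]
  refine Finset.sum_le_sum fun i _ => ?_
  rw [lintegral_finsetSum _ fun i _ => by fun_prop]
  refine Finset.sum_le_sum fun j _ => ?_
  exact fsd_cov2 μ i j (hH i j) hH T T (hHb i j) (hR i) (hC j)


/-- Jensen inequality for the concave power `1/p`. -/
lemma fsd_jensen {X : Type*} [MeasurableSpace X] (P : Measure X) [IsProbabilityMeasure P]
    (S : X → ℝ≥0∞) (hS : Measurable S) (p : ℝ) (hp : 1 ≤ p) :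
    ∫⁻ x, S x ^ (1/p) ∂P ≤ (∫⁻ x, S x ∂P) ^ (1/p) := by
  have hp0 : 0 < p := by linarith
  have h := ENNReal.lintegral_mul_norm_pow_le (μ := P) (f := S) (g := fun _ => 1)
    hS.aemeasurable aemeasurable_const (p := 1/p) (q := 1 - 1/p) (by positivity)
    (by rw [sub_nonneg, div_le_one hp0]; exact hp) (by ring)
  simpa using h

lemma fsd_rpow_sum {ι : Type*} (s : Finset ι) (f : ι → ℝ≥0∞) (p : ℝ) (hp : 1 ≤ p) :
    (∑ i ∈ s, f i) ^ (1/p) ≤ ∑ i ∈ s, f i ^ (1/p) := by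
  have hp0 : 0 < p := by linarith
  refine Finset.le_sum_of_subadditive (fun a : ℝ≥0∞ => a ^ (1/p)) ?_ ?_ s f
  · simp [hp0]
  · intro a b
    exact ENNReal.rpow_add_le_add_rpow a b (by positivity) (by rw [div_le_one hp0]; exact hp)

lemma fsd_upper_c {ι : Type*} [Fintype ι] (μ : Measure Ω) [IsProbabilityMeasure μ]
    (g : ι → ι → Ω × Ω → ℝ≥0∞) (hg : ∀ i j, Measurable (g i j)) (p : ℝ) (hp : 1 ≤ p) :
    ∫⁻ x : ι → Ω, ∫⁻ y : ι → Ω, (∑ i, ∑ j, g i j (x i, y j)) ^ (1/p)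
      ∂Measure.pi (fun _ => μ) ∂Measure.pi (fun _ => μ) ≤
    ∑ i, ∫⁻ ξ, (∑ j, ∫⁻ υ, g i j (ξ, υ) ∂μ) ^ (1/p) ∂μ := by
  have mr : ∀ i, Measurable (fun ξ => (∑ j, ∫⁻ υ, g i j (ξ, υ) ∂μ) ^ (1/p)) := fun i =>
    (Finset.measurable_fun_sum _ fun j _ => (hg i j).lintegral_prod_right').pow_const _
  calc _ ≤ ∫⁻ x : ι → Ω, ∑ i, (∑ j, ∫⁻ υ, g i j (x i, υ) ∂μ) ^ (1/p)
        ∂Measure.pi (fun _ => μ) := by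
        refine lintegral_mono fun x => ?_
        calc _ ≤ ∫⁻ y : ι → Ω, ∑ i, (∑ j, g i j (x i, y j)) ^ (1/p)
              ∂Measure.pi (fun _ => μ) := lintegral_mono fun y => fsd_rpow_sum _ _ p hp
          _ = ∑ i, ∫⁻ y : ι → Ω, (∑ j, g i j (x i, y j)) ^ (1/p)
              ∂Measure.pi (fun _ => μ) := lintegral_finsetSum _ fun i _ => by fun_prop
          _ ≤ ∑ i, (∫⁻ y : ι → Ω, ∑ j, g i j (x i, y j) ∂Measure.pi (fun _ => μ)) ^ (1/p) :=
              Finset.sum_le_sum fun i _ => fsd_jensen _ _ (by fun_prop) p hp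
          _ = _ := by
              refine Finset.sum_congr rfl fun i _ => ?_
              rw [lintegral_finsetSum _ fun j _ => by fun_prop]
              congr 1
              exact Finset.sum_congr rfl fun j _ =>
                fsd_eval μ j (v := fun υ => g i j (x i, υ)) (by fun_prop)
    _ = ∑ i, ∫⁻ x : ι → Ω, (∑ j, ∫⁻ υ, g i j (x i, υ) ∂μ) ^ (1/p) ∂Measure.pi (fun _ => μ) :=
        lintegral_finsetSum _ fun i _ => (mr i).comp (measurable_pi_apply i)
    _ = _ := Finset.sum_congr rfl fun i _ => fsd_eval μ i (mr i)

lemma fsd_upper {ι : Type*} [Fintype ι] (μ : Measure Ω) [IsProbabilityMeasure μ]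
    (f a b c d : ι → ι → Ω × Ω → ℝ≥0∞)
    (ha : ∀ i j, Measurable (a i j)) (hb : ∀ i j, Measurable (b i j))
    (hc : ∀ i j, Measurable (c i j)) (hd : ∀ i j, Measurable (d i j)) (p : ℝ) (hp : 1 ≤ p)
    (h : ∀ i j q, f i j q ≤ a i j q + b i j q + c i j q + d i j q) :
    ∫⁻ x : ι → Ω, ∫⁻ y : ι → Ω, (∑ i, ∑ j, f i j (x i, y j) ^ p) ^ (1/p)
      ∂Measure.pi (fun _ => μ) ∂Measure.pi (fun _ => μ) ≤
    (∑ i, ∑ j, ∫⁻ ξ, ∫⁻ υ, a i j (ξ, υ) ∂μ ∂μ)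
    + (∑ i, ∑ j, ∫⁻ ξ, ∫⁻ υ, b i j (ξ, υ) ^ p ∂μ ∂μ) ^ (1/p)
    + ∑ i, ∫⁻ ξ, (∑ j, ∫⁻ υ, c i j (ξ, υ) ^ p ∂μ) ^ (1/p) ∂μ
    + ∑ j, ∫⁻ υ, (∑ i, ∫⁻ ξ, d i j (ξ, υ) ^ p ∂μ) ^ (1/p) ∂μ := by
  have hp0 : 0 < p := by linarith
  have mink : ∀ u v : ι → ι → ℝ≥0∞, (∑ i, ∑ j, (u i j + v i j) ^ p) ^ (1/p) ≤
      (∑ i, ∑ j, u i j ^ p) ^ (1/p) + (∑ i, ∑ j, v i j ^ p) ^ (1/p) := by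
    intro u v
    have := ENNReal.Lp_add_le (Finset.univ : Finset (ι × ι)) (fun α => u α.1 α.2)
      (fun α => v α.1 α.2) hp
    simpa only [Fintype.sum_prod_type] using this
  have pw : ∀ x y : ι → Ω, (∑ i, ∑ j, f i j (x i, y j) ^ p) ^ (1/p) ≤
      (∑ i, ∑ j, a i j (x i, y j)) + (∑ i, ∑ j, b i j (x i, y j) ^ p) ^ (1/p)
      + (∑ i, ∑ j, c i j (x i, y j) ^ p) ^ (1/p)
      + (∑ i, ∑ j, d i j (x i, y j) ^ p) ^ (1/p) := by
    intro x y
    calc _ ≤ (∑ i, ∑ j, (a i j (x i, y j) + b i j (x i, y j) + c i j (x i, y j)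
          + d i j (x i, y j)) ^ p) ^ (1/p) := by
          gcongr with i _ j
          exact h i j _
      _ ≤ (∑ i, ∑ j, (a i j (x i, y j)) ^ p) ^ (1/p)
        + (∑ i, ∑ j, b i j (x i, y j) ^ p) ^ (1/p)
        + (∑ i, ∑ j, c i j (x i, y j) ^ p) ^ (1/p)
        + (∑ i, ∑ j, d i j (x i, y j) ^ p) ^ (1/p) := by
          refine (mink _ _).trans ?_
          gcongr
          refine (mink _ _).trans ?_
          gcongr
          exact mink _ _
      _ ≤ _ := by
          gcongr
          refine (fsd_rpow_sum _ _ p hp).trans ?_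
          gcongr with i
          refine (fsd_rpow_sum _ _ p hp).trans (le_of_eq ?_)
          refine Finset.sum_congr rfl fun j _ => ?_
          rw [← ENNReal.rpow_mul, mul_one_div_cancel hp0.ne', ENNReal.rpow_one]
  set π := Measure.pi (fun _ : ι => μ) with hπ
  have m1 : Measurable fun w : (ι → Ω) × (ι → Ω) => ∑ i, ∑ j, a i j (w.1 i, w.2 j) := by fun_prop
  have m2 : Measurable fun w : (ι → Ω) × (ι → Ω) =>
    (∑ i, ∑ j, b i j (w.1 i, w.2 j) ^ p) ^ (1/p) := by fun_prop
  have m3 : Measurable fun w : (ι → Ω) × (ι → Ω) =>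
    (∑ i, ∑ j, c i j (w.1 i, w.2 j) ^ p) ^ (1/p) := by fun_prop
  have m4 : Measurable fun w : (ι → Ω) × (ι → Ω) =>
    (∑ i, ∑ j, d i j (w.1 i, w.2 j) ^ p) ^ (1/p) := by fun_prop
  have split : ∫⁻ x : ι → Ω, ∫⁻ y : ι → Ω, (∑ i, ∑ j, f i j (x i, y j) ^ p) ^ (1/p) ∂π ∂π ≤
      ∫⁻ w, (∑ i, ∑ j, a i j (w.1 i, w.2 j)) ∂(π.prod π)
      + ∫⁻ w, (∑ i, ∑ j, b i j (w.1 i, w.2 j) ^ p) ^ (1/p) ∂(π.prod π)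
      + ∫⁻ w, (∑ i, ∑ j, c i j (w.1 i, w.2 j) ^ p) ^ (1/p) ∂(π.prod π)
      + ∫⁻ w, (∑ i, ∑ j, d i j (w.1 i, w.2 j) ^ p) ^ (1/p) ∂(π.prod π) := by
    rw [← lintegral_add_left m1, ← lintegral_add_left (m1.fun_add m2),
      ← lintegral_add_left ((m1.fun_add m2).fun_add m3),
      lintegral_prod _ (((m1.fun_add m2).fun_add m3).fun_add m4).aemeasurable]
    exact lintegral_mono fun x => lintegral_mono fun y => pw x y
  have it : ∀ g : ι → ι → Ω × Ω → ℝ≥0∞, (∀ i j, Measurable (g i j)) →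
      ∫⁻ w, (∑ i, ∑ j, g i j (w.1 i, w.2 j)) ∂(π.prod π) =
      ∑ i, ∑ j, ∫⁻ ξ, ∫⁻ υ, g i j (ξ, υ) ∂μ ∂μ := by
    intro g hg
    rw [lintegral_finsetSum _ fun i _ => by fun_prop]
    refine Finset.sum_congr rfl fun i _ => ?_
    rw [lintegral_finsetSum _ fun i _ => by fun_prop]
    refine Finset.sum_congr rfl fun j _ => ?_
    rw [fsd_eval2 μ i j (hg i j), lintegral_prod _ (hg i j).aemeasurable]
  refine split.trans ?_
  gcongr
  · exact (it a ha).le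
  · refine (fsd_jensen _ _ (by fun_prop) p hp).trans (le_of_eq ?_)
    rw [it (fun i j q => b i j q ^ p) (fun i j => by fun_prop)]
  · rw [lintegral_prod _ m3.aemeasurable]
    exact fsd_upper_c μ (fun i j q => c i j q ^ p) (fun i j => by fun_prop) p hp
  · rw [lintegral_prod_symm _ m4.aemeasurable]
    refine le_trans (le_of_eq ?_) (fsd_upper_c μ (fun j i q => d i j (q.2, q.1) ^ p)
      (fun i j => by fun_prop) p hp)
    refine lintegral_congr fun y => lintegral_congr fun x => ?_
    rw [Finset.sum_comm]

/-- Fibre estimates. -/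
lemma fsd_fiber {ι : Type*} [Fintype ι] (μ : Measure Ω) [IsProbabilityMeasure μ]
    (G : ι → Ω → ℝ≥0∞) (hG : ∀ i, Measurable (G i)) (κ : ℝ≥0∞) (p : ℝ) (hp : 1 ≤ p)
    (hκ0 : κ ≠ 0)
    (hF : ∫⁻ x : ι → Ω, (∑ i, G i (x i) ^ p) ^ (1/p) ∂Measure.pi (fun _ => μ) ≤ κ) :
    ∑ i, ∫⁻ ξ, {ξ | 64 * κ < G i ξ}.indicator (1 : Ω → ℝ≥0∞) ξ ∂μ ≤ 1 / 4 ∧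
    ∑ i, ∫⁻ ξ, {ξ | 64 * κ < G i ξ}.indicator (G i) ξ ∂μ ≤ 4 * κ ∧
    ∑ i, ∫⁻ ξ, {ξ | G i ξ ≤ 64 * κ}.indicator (fun ξ => G i ξ ^ p) ξ ∂μ ≤ (64 * κ) ^ p := by
  have hp0 : 0 < p := by linarith
  by_cases hκ : κ = ⊤
  · subst hκ
    simp [ENNReal.top_rpow_of_pos hp0]
  have hle : ∀ i (x : ι → Ω), G i (x i) ≤ (∑ i, G i (x i) ^ p) ^ (1/p) := by
    intro i x
    calc G i (x i) = (G i (x i) ^ p) ^ (1/p) := by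
          rw [← ENNReal.rpow_mul, mul_one_div_cancel hp0.ne', ENNReal.rpow_one]
      _ ≤ _ := by
          gcongr
          exact Finset.single_le_sum (f := fun i => G i (x i) ^ p) (fun _ _ => zero_le)
            (Finset.mem_univ i)
  obtain ⟨h1, h2⟩ := fsd_one_weight μ G hG _ κ hκ0 hκ hle hF
  exact ⟨h1, h2, fsd_one_moment μ G hG κ p hp hκ hF⟩

lemma fsd_row {ι : Type*} [Fintype ι] (μ : Measure Ω) [IsProbabilityMeasure μ]
    (g : ι → ι → Ω × Ω → ℝ≥0∞) (hg : ∀ i j, Measurable (g i j)) (p : ℝ) (hp : 1 ≤ p)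
    (N : ι → Ω → ℝ≥0∞)
    (hN : ∀ i ξ, N i ξ = ∫⁻ y : ι → Ω, (∑ j, g i j (ξ, y j) ^ p) ^ (1/p) ∂Measure.pi (fun _ => μ))
    (hF : ∫⁻ x : ι → Ω, ∫⁻ y : ι → Ω, (∑ i, ∑ j, g i j (x i, y j) ^ p) ^ (1/p)
      ∂Measure.pi (fun _ => μ) ∂Measure.pi (fun _ => μ) ≤ 1) :
    (∀ i, Measurable (N i)) ∧
    ∑ i, ∫⁻ ξ, ∑ j, ∫⁻ υ,
      {q : Ω × Ω | 64 < N i q.1 ∧ 64 * N i q.1 < g i j q}.indicator (g i j) (ξ, υ) ∂μ ∂μ ≤ 16 ∧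
    ∑ i, ∫⁻ ξ, (∑ j, ∫⁻ υ, {q : Ω × Ω | 64 < N i q.1 ∧ g i j q ≤ 64 * N i q.1}.indicator
      (fun q => g i j q ^ p) (ξ, υ) ∂μ) ^ (1/p) ∂μ ≤ 256 := by
  have hp0 : 0 < p := by linarith
  have mN : ∀ i, Measurable (N i) := by
    intro i
    have : N i = fun ξ => ∫⁻ y : ι → Ω, (∑ j, g i j (ξ, y j) ^ p) ^ (1/p)
      ∂Measure.pi (fun _ => μ) := funext (hN i)
    rw [this]
    have m : Measurable (fun w : Ω × (ι → Ω) => (∑ j, g i j (w.1, w.2 j) ^ p) ^ (1/p)) := by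
      fun_prop
    exact m.lintegral_prod_right'
  have hA := (fsd_one_weight μ N mN _ 1 one_ne_zero ENNReal.one_ne_top (fun i x => by
    rw [hN]
    refine lintegral_mono fun y => ?_
    refine ENNReal.rpow_le_rpow ?_ (by positivity)
    exact Finset.single_le_sum (f := fun i => ∑ j, g i j (x i, y j) ^ p) (fun _ _ => zero_le)
            (Finset.mem_univ i)) hF).2
  simp only [mul_one] at hA
  have mA : ∀ i, Measurable ({ξ | 64 < N i ξ}.indicator (N i)) := fun i =>
    (mN i).indicator (measurableSet_lt measurable_const (mN i))
  refine ⟨mN, ?_, ?_⟩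
  · calc _ ≤ ∑ i, ∫⁻ ξ, 4 * {ξ | 64 < N i ξ}.indicator (N i) ξ ∂μ := by
          gcongr with i _ ξ
          by_cases h : 64 < N i ξ
          · have := (fsd_fiber μ (fun j υ => g i j (ξ, υ)) (fun j => by fun_prop) (N i ξ) p hp
              (by positivity) (hN i ξ).ge).2.1
            simpa [Set.indicator_apply, h] using this
          · simp [Set.indicator_apply, h]
      _ = 4 * ∑ i, ∫⁻ ξ, {ξ | 64 < N i ξ}.indicator (N i) ξ ∂μ := by
          rw [Finset.mul_sum]
          exact Finset.sum_congr rfl fun i _ => lintegral_const_mul _ (mA i)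
      _ ≤ 4 * 4 := by gcongr
      _ = 16 := by norm_num
  · calc _ ≤ ∑ i, ∫⁻ ξ, 64 * {ξ | 64 < N i ξ}.indicator (N i) ξ ∂μ := by
          gcongr with i _ ξ
          by_cases h : 64 < N i ξ
          · have := (fsd_fiber μ (fun j υ => g i j (ξ, υ)) (fun j => by fun_prop) (N i ξ) p hp
              (by positivity) (hN i ξ).ge).2.2
            rw [one_div, ENNReal.rpow_inv_le_iff hp0]
            simpa [Set.indicator_apply, h] using this
          · simp [Set.indicator_apply, h, hp0]
      _ = 64 * ∑ i, ∫⁻ ξ, {ξ | 64 < N i ξ}.indicator (N i) ξ ∂μ := by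
          rw [Finset.mul_sum]
          exact Finset.sum_congr rfl fun i _ => lintegral_const_mul _ (mA i)
      _ ≤ 64 * 4 := by gcongr
      _ = 256 := by norm_num


lemma fsd_cases (a b c d e a' b' c' d' e' : Prop) (ha : a' ↔ ¬ a) (hb : b' ↔ ¬ b)
    (hc : c' ↔ ¬ c) (hd : d' ↔ ¬ d) (he : e' ↔ ¬ e) :
    ((((a ∧ c) ∨ (a' ∧ b ∧ d)) ∨ (a' ∧ b' ∧ e)) ∧ ¬ (a' ∧ b' ∧ e') ∧ ¬ (a ∧ c') ∧ ¬ (a' ∧ b ∧ d')) ∨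
    (¬ (((a ∧ c) ∨ (a' ∧ b ∧ d)) ∨ (a' ∧ b' ∧ e)) ∧ (a' ∧ b' ∧ e') ∧ ¬ (a ∧ c') ∧ ¬ (a' ∧ b ∧ d')) ∨
    (¬ (((a ∧ c) ∨ (a' ∧ b ∧ d)) ∨ (a' ∧ b' ∧ e)) ∧ ¬ (a' ∧ b' ∧ e') ∧ (a ∧ c') ∧ ¬ (a' ∧ b ∧ d')) ∨
    (¬ (((a ∧ c) ∨ (a' ∧ b ∧ d)) ∨ (a' ∧ b' ∧ e)) ∧ ¬ (a' ∧ b' ∧ e') ∧ ¬ (a ∧ c') ∧ (a' ∧ b ∧ d')) := by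
  rw [ha, hb, hc, hd, he]
  by_cases a <;> by_cases b <;> by_cases c <;> by_cases d <;> by_cases e <;> simp [*]

set_option maxHeartbeats 1000000 in
lemma fsd_lower {ι : Type*} [Fintype ι] (μ : Measure Ω) [IsProbabilityMeasure μ]
    (g : ι → ι → Ω × Ω → ℝ≥0∞) (hg : ∀ i j, Measurable (g i j)) (p : ℝ) (hp : 1 ≤ p)
    (hF : ∫⁻ x : ι → Ω, ∫⁻ y : ι → Ω, (∑ i, ∑ j, g i j (x i, y j) ^ p) ^ (1/p)
      ∂Measure.pi (fun _ => μ) ∂Measure.pi (fun _ => μ) ≤ 1) :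
    ∃ SA SB SC SD : ι → ι → Set (Ω × Ω),
      (∀ i j, MeasurableSet (SA i j)) ∧ (∀ i j, MeasurableSet (SB i j)) ∧
      (∀ i j, MeasurableSet (SC i j)) ∧ (∀ i j, MeasurableSet (SD i j)) ∧
      (∀ i j q, (q ∈ SA i j ∧ q ∉ SB i j ∧ q ∉ SC i j ∧ q ∉ SD i j) ∨
        (q ∉ SA i j ∧ q ∈ SB i j ∧ q ∉ SC i j ∧ q ∉ SD i j) ∨
        (q ∉ SA i j ∧ q ∉ SB i j ∧ q ∈ SC i j ∧ q ∉ SD i j) ∨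
        (q ∉ SA i j ∧ q ∉ SB i j ∧ q ∉ SC i j ∧ q ∈ SD i j)) ∧
      ∑ i, ∑ j, ∫⁻ ξ, ∫⁻ υ, (SA i j).indicator (g i j) (ξ, υ) ∂μ ∂μ ≤ 36 ∧
      (∑ i, ∑ j, ∫⁻ ξ, ∫⁻ υ, (SB i j).indicator (fun q => g i j q ^ p) (ξ, υ) ∂μ ∂μ) ^ (1/p)
        ≤ 12288 ∧
      ∑ i, ∫⁻ ξ, (∑ j, ∫⁻ υ, (SC i j).indicator (fun q => g i j q ^ p) (ξ, υ) ∂μ) ^ (1/p) ∂μ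
        ≤ 256 ∧
      ∑ j, ∫⁻ υ, (∑ i, ∫⁻ ξ, (SD i j).indicator (fun q => g i j q ^ p) (ξ, υ) ∂μ) ^ (1/p) ∂μ
        ≤ 256 := by
  have hp0 : 0 < p := by linarith
  set π := Measure.pi (fun _ : ι => μ) with hπ
  have mF : Measurable fun w : (ι → Ω) × (ι → Ω) =>
    (∑ i, ∑ j, g i j (w.1 i, w.2 j) ^ p) ^ (1/p) := by fun_prop
  have hFp : ∫⁻ w, (∑ i, ∑ j, g i j (w.1 i, w.2 j) ^ p) ^ (1/p) ∂(π.prod π) ≤ 1 := by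
    rw [lintegral_prod _ mF.aemeasurable]; exact hF
  have hFs : ∫⁻ y : ι → Ω, ∫⁻ x : ι → Ω, (∑ j, ∑ i, g i j (x i, y j) ^ p) ^ (1/p) ∂π ∂π ≤ 1 := by
    rw [lintegral_prod_symm _ mF.aemeasurable] at hFp
    refine le_trans (le_of_eq ?_) hFp
    refine lintegral_congr fun y => lintegral_congr fun x => ?_
    rw [Finset.sum_comm]
  obtain ⟨N, hN⟩ : ∃ N : ι → Ω → ℝ≥0∞, ∀ i ξ, N i ξ =
    ∫⁻ y : ι → Ω, (∑ j, g i j (ξ, y j) ^ p) ^ (1/p) ∂π := ⟨_, fun _ _ => rfl⟩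
  obtain ⟨M, hM⟩ : ∃ M : ι → Ω → ℝ≥0∞, ∀ j υ, M j υ =
    ∫⁻ x : ι → Ω, (∑ i, g i j (x i, υ) ^ p) ^ (1/p) ∂π := ⟨_, fun _ _ => rfl⟩
  obtain ⟨mN, hNa, hNc⟩ := fsd_row μ g hg p hp N hN hF
  obtain ⟨mM, hMa, hMc⟩ := fsd_row μ (fun j i q => g i j (q.2, q.1)) (fun j i => by fun_prop)
    p hp M hM hFs
  have mN1 : ∀ i, Measurable fun q : Ω × Ω => N i q.1 := fun i => by fun_prop
  have mM2 : ∀ j, Measurable fun q : Ω × Ω => M j q.2 := fun i => by fun_prop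
  have sN : ∀ i, MeasurableSet {q : Ω × Ω | 64 < N i q.1} := fun i =>
    measurableSet_lt measurable_const (mN1 i)
  have sM : ∀ j, MeasurableSet {q : Ω × Ω | 64 < M j q.2} := fun i =>
    measurableSet_lt measurable_const (mM2 i)
  have sN' : ∀ i, MeasurableSet {q : Ω × Ω | N i q.1 ≤ 64} := fun i =>
    measurableSet_le (mN1 i) measurable_const
  have sM' : ∀ j, MeasurableSet {q : Ω × Ω | M j q.2 ≤ 64} := fun i =>
    measurableSet_le (mM2 i) measurable_const
  set A1 : ι → ι → Set (Ω × Ω) := fun i j => {q | 64 < N i q.1 ∧ 64 * N i q.1 < g i j q} with hA1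
  set SC : ι → ι → Set (Ω × Ω) := fun i j => {q | 64 < N i q.1 ∧ g i j q ≤ 64 * N i q.1} with hSC
  set A2 : ι → ι → Set (Ω × Ω) := fun i j =>
    {q | N i q.1 ≤ 64 ∧ 64 < M j q.2 ∧ 64 * M j q.2 < g i j q} with hA2
  set SD : ι → ι → Set (Ω × Ω) := fun i j =>
    {q | N i q.1 ≤ 64 ∧ 64 < M j q.2 ∧ g i j q ≤ 64 * M j q.2} with hSD
  set A3 : ι → ι → Set (Ω × Ω) := fun i j =>
    {q | N i q.1 ≤ 64 ∧ M j q.2 ≤ 64 ∧ 64 * 64 < g i j q} with hA3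
  set SB : ι → ι → Set (Ω × Ω) := fun i j =>
    {q | N i q.1 ≤ 64 ∧ M j q.2 ≤ 64 ∧ g i j q ≤ 64 * 64} with hSB
  have mA1 : ∀ i j, MeasurableSet (A1 i j) := fun i j =>
    (sN i).inter (measurableSet_lt ((mN1 i).const_mul _) (hg i j))
  have mSC : ∀ i j, MeasurableSet (SC i j) := fun i j =>
    (sN i).inter (measurableSet_le (hg i j) ((mN1 i).const_mul _))
  have mA2 : ∀ i j, MeasurableSet (A2 i j) := fun i j =>
    (sN' i).inter ((sM j).inter (measurableSet_lt ((mM2 j).const_mul _) (hg i j)))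
  have mSD : ∀ i j, MeasurableSet (SD i j) := fun i j =>
    (sN' i).inter ((sM j).inter (measurableSet_le (hg i j) ((mM2 j).const_mul _)))
  have mA3 : ∀ i j, MeasurableSet (A3 i j) := fun i j =>
    (sN' i).inter ((sM' j).inter (measurableSet_lt measurable_const (hg i j)))
  have mSB : ∀ i j, MeasurableSet (SB i j) := fun i j =>
    (sN' i).inter ((sM' j).inter (measurableSet_le (hg i j) measurable_const))
  -- fibre estimates in the good region
  have fN : ∀ i ξ, N i ξ ≤ 64 → _ := fun i ξ h =>
    fsd_fiber μ (fun j υ => g i j (ξ, υ)) (fun j => by fun_prop) 64 p hp (by norm_num)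
      ((hN i ξ).ge.trans h)
  have fM : ∀ j υ, M j υ ≤ 64 → _ := fun j υ h =>
    fsd_fiber μ (fun i ξ => g i j (ξ, υ)) (fun j => by fun_prop) 64 p hp (by norm_num)
      ((hM j υ).ge.trans h)
  have toProd : ∀ (V : ι → ι → Ω × Ω → ℝ≥0∞), (∀ i j, Measurable (V i j)) →
      ∑ i, ∑ j, ∫⁻ q, V i j q ∂(μ.prod μ) = ∑ i, ∑ j, ∫⁻ ξ, ∫⁻ υ, V i j (ξ, υ) ∂μ ∂μ :=
    fun V hV => Finset.sum_congr rfl fun i _ => Finset.sum_congr rfl fun j _ =>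
      lintegral_prod _ (hV i j).aemeasurable
  have toProd' : ∀ (V : ι → ι → Ω × Ω → ℝ≥0∞), (∀ i j, Measurable (V i j)) →
      ∑ i, ∑ j, ∫⁻ q, V i j q ∂(μ.prod μ) = ∑ j, ∫⁻ υ, ∑ i, ∫⁻ ξ, V i j (ξ, υ) ∂μ ∂μ := by
    intro V hV
    rw [Finset.sum_comm]
    refine Finset.sum_congr rfl fun j _ => ?_
    rw [lintegral_finsetSum _ fun i _ => (hV i j).lintegral_prod_left']
    refine Finset.sum_congr rfl fun i _ => ?_
    rw [lintegral_prod_symm _ (hV i j).aemeasurable]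
  have toProd'' : ∀ (V : ι → ι → Ω × Ω → ℝ≥0∞), (∀ i j, Measurable (V i j)) →
      ∑ i, ∑ j, ∫⁻ q, V i j q ∂(μ.prod μ) = ∑ i, ∫⁻ ξ, ∑ j, ∫⁻ υ, V i j (ξ, υ) ∂μ ∂μ := by
    intro V hV
    refine Finset.sum_congr rfl fun i _ => ?_
    rw [lintegral_finsetSum _ fun j _ => (hV i j).lintegral_prod_right']
    refine Finset.sum_congr rfl fun j _ => ?_
    rw [lintegral_prod _ (hV i j).aemeasurable]
  have miA1 : ∀ i j, Measurable ((A1 i j).indicator (g i j)) := fun i j =>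
    (hg i j).indicator (mA1 i j)
  have miA2 : ∀ i j, Measurable ((A2 i j).indicator (g i j)) := fun i j =>
    (hg i j).indicator (mA2 i j)
  have miA3 : ∀ i j, Measurable ((A3 i j).indicator (g i j)) := fun i j =>
    (hg i j).indicator (mA3 i j)
  have bA1 : ∑ i, ∑ j, ∫⁻ q, (A1 i j).indicator (g i j) q ∂(μ.prod μ) ≤ 16 := by
    rw [toProd'' _ miA1]; exact hNa
  have bA2 : ∑ i, ∑ j, ∫⁻ q, (A2 i j).indicator (g i j) q ∂(μ.prod μ) ≤ 16 := by
    rw [toProd' _ miA2]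
    refine le_trans ?_ hMa
    gcongr with j _ υ i _ ξ
    by_cases h : (ξ, υ) ∈ A2 i j
    · rw [Set.indicator_of_mem h, Set.indicator_of_mem]
      exact h.2
    · rw [Set.indicator_of_notMem h]; exact zero_le
  have bA3 : ∑ i, ∑ j, ∫⁻ q, (A3 i j).indicator (g i j) q ∂(μ.prod μ) ≤ 4 := by
    have := fsd_two_weight μ g hg A3 mA3 _ 1 one_ne_zero ENNReal.one_ne_top
      (fun i j w => ?_) (fun i j q hq => ?_) hFp ?_ ?_
    · simpa using this
    · calc g i j (w.1 i, w.2 j) = (g i j (w.1 i, w.2 j) ^ p) ^ (1/p) := by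
            rw [← ENNReal.rpow_mul, mul_one_div_cancel hp0.ne', ENNReal.rpow_one]
        _ ≤ (∑ i, ∑ j, g i j (w.1 i, w.2 j) ^ p) ^ (1/p) := by
            refine ENNReal.rpow_le_rpow ?_ (by positivity)
            refine le_trans ?_ (Finset.single_le_sum (f := fun i => ∑ j, g i j (w.1 i, w.2 j) ^ p)
              (fun _ _ => zero_le) (Finset.mem_univ i))
            exact Finset.single_le_sum (f := fun j => g i j (w.1 i, w.2 j) ^ p)
              (fun _ _ => zero_le) (Finset.mem_univ j)
    · refine le_trans ?_ hq.2.2.le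
      gcongr; norm_num
    · intro i ξ
      by_cases h : N i ξ ≤ 64
      · refine le_trans ?_ (fN i ξ h).1
        gcongr with l _ υ
        by_cases h' : (ξ, υ) ∈ A3 i l
        · rw [Set.indicator_of_mem h', Set.indicator_of_mem]
          · simp
          · exact h'.2.2
        · rw [Set.indicator_of_notMem h']; exact zero_le
      · simp [hA3, h]
    · intro j υ
      by_cases h : M j υ ≤ 64
      · refine le_trans ?_ (fM j υ h).1
        gcongr with l _ ξ
        by_cases h' : (ξ, υ) ∈ A3 l j
        · rw [Set.indicator_of_mem h', Set.indicator_of_mem]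
          · simp
          · exact h'.2.2
        · rw [Set.indicator_of_notMem h']; exact zero_le
      · simp [hA3, h]
  set H : ι → ι → Ω × Ω → ℝ≥0∞ := fun i j => (SB i j).indicator (fun q => g i j q ^ p) with hH
  have mH : ∀ i j, Measurable (H i j) := fun i j =>
    ((hg i j).pow_const p).indicator (mSB i j)
  have bB : ∑ i, ∑ j, ∫⁻ q, H i j q ∂(μ.prod μ) ≤
      max ((64 * 64) ^ p + (64 * 64) ^ p + (64 * 64) ^ p) ((8 * 1) ^ p) := by
    refine fsd_two_moment μ H mH 1 ((64 * 64) ^ p) p hp ENNReal.one_ne_top (by finiteness)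
      ?_ ?_ ?_ ?_
    · intro i j q
      by_cases h : q ∈ SB i j
      · simp only [hH]
        rw [Set.indicator_of_mem h]
        exact ENNReal.rpow_le_rpow h.2.2 hp0.le
      · simp only [hH]
        rw [Set.indicator_of_notMem h]; exact zero_le
    · intro i ξ
      by_cases h : N i ξ ≤ 64
      · refine le_trans ?_ (fN i ξ h).2.2
        gcongr with l _ υ
        by_cases h' : (ξ, υ) ∈ SB i l
        · simp only [hH]
          rw [Set.indicator_of_mem h', Set.indicator_of_mem]
          exact h'.2.2
        · simp only [hH]
          rw [Set.indicator_of_notMem h']; exact zero_le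
      · simp [hH, hSB, h]
    · intro j υ
      by_cases h : M j υ ≤ 64
      · refine le_trans ?_ (fM j υ h).2.2
        gcongr with l _ ξ
        by_cases h' : (ξ, υ) ∈ SB l j
        · simp only [hH]
          rw [Set.indicator_of_mem h', Set.indicator_of_mem]
          exact h'.2.2
        · simp only [hH]
          rw [Set.indicator_of_notMem h']; exact zero_le
      · simp [hH, hSB, h]
    · refine le_trans (lintegral_mono fun w => ?_) hFp
      gcongr with i _ j
      exact Set.indicator_le_self _ (fun q => g i j q ^ p) _
  refine ⟨fun i j => A1 i j ∪ A2 i j ∪ A3 i j, SB, SC, SD,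
    fun i j => ((mA1 i j).union (mA2 i j)).union (mA3 i j), mSB, mSC, mSD, ?_, ?_, ?_, hNc, ?_⟩
  · intro i j q
    exact fsd_cases _ _ _ _ _ _ _ _ _ _ not_lt.symm not_lt.symm not_lt.symm not_lt.symm not_lt.symm
  · rw [← toProd _ fun i j => (hg i j).indicator (((mA1 i j).union (mA2 i j)).union (mA3 i j))]
    calc _ ≤ ∑ i, ∑ j, (∫⁻ q, (A1 i j).indicator (g i j) q ∂(μ.prod μ)
          + ∫⁻ q, (A2 i j).indicator (g i j) q ∂(μ.prod μ)
          + ∫⁻ q, (A3 i j).indicator (g i j) q ∂(μ.prod μ)) := by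
          gcongr with i _ j
          rw [← lintegral_add_left (miA1 i j),
            ← lintegral_add_left ((miA1 i j).fun_add (miA2 i j))]
          refine lintegral_mono fun q => ?_
          by_cases h : q ∈ A1 i j ∪ A2 i j ∪ A3 i j
          · rw [Set.indicator_of_mem h]
            rcases h with (h | h) | h
            · rw [Set.indicator_of_mem h, add_assoc]; exact le_self_add
            · rw [Set.indicator_of_mem h, add_right_comm]; exact le_add_self
            · rw [Set.indicator_of_mem h (f := g i j)]; exact le_add_self
          · rw [Set.indicator_of_notMem h]; exact zero_le
      _ ≤ 16 + 16 + 4 := by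
          simp only [Finset.sum_add_distrib]
          gcongr
      _ = 36 := by norm_num
  · rw [← toProd _ mH]
    rw [one_div, ENNReal.rpow_inv_le_iff hp0]
    refine bB.trans (max_le ?_ ?_)
    · calc ((64 * 64) ^ p + (64 * 64) ^ p + (64 * 64) ^ p : ℝ≥0∞)
          = 3 * (64 * 64) ^ p := by ring
        _ ≤ 3 ^ p * (64 * 64) ^ p := by
          gcongr
          calc (3 : ℝ≥0∞) = 3 ^ (1 : ℝ) := by simp
            _ ≤ 3 ^ p := ENNReal.rpow_le_rpow_of_exponent_le (by norm_num) hp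
        _ = 12288 ^ p := by
          rw [← ENNReal.mul_rpow_of_nonneg _ _ hp0.le]; norm_num
    · refine ENNReal.rpow_le_rpow (by norm_num) hp0.le
  · refine le_trans ?_ hMc
    gcongr with j _ υ i _ ξ
    by_cases h : (ξ, υ) ∈ SD i j
    · rw [Set.indicator_of_mem h, Set.indicator_of_mem]
      exact h.2
    · rw [Set.indicator_of_notMem h]; exact zero_le


/-- **Four-summand decomposition theorem** (Theorem `4summand` of the paper):
`∫∫ (∑_{i,j} |f i j (x i) (y j)|^p)^{1/p} dx dy` is equivalent, with constants independent
of `p` and `n`, to `inf { ‖a‖ + ‖b‖ + ‖c‖ + ‖d‖ }` over decompositions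
`f = a + b + c + d`, in the four mixed norms on disjoint unions; the upper bound holds
with constant 1, and a near-optimal decomposition with pairwise disjointly supported
pieces exists. -/
theorem four_summand_decomposition :
    ∃ C : ℝ≥0∞, 0 < C ∧ C ≠ ⊤ ∧
      ∀ (Ω : Type u) [MeasurableSpace Ω] (μ : Measure Ω) [IsProbabilityMeasure μ]
        (n : ℕ) (p : ℝ), 1 ≤ p →
      ∀ f : Fin n → Fin n → Ω → Ω → ℝ,
        (∀ i j, Measurable (Function.uncurry (f i j))) →
        ((∀ a b c d : Fin n → Fin n → Ω → Ω → ℝ,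
            (∀ i j, Measurable (Function.uncurry (a i j))) →
            (∀ i j, Measurable (Function.uncurry (b i j))) →
            (∀ i j, Measurable (Function.uncurry (c i j))) →
            (∀ i j, Measurable (Function.uncurry (d i j))) →
            (∀ i j ξ υ, f i j ξ υ = a i j ξ υ + b i j ξ υ + c i j ξ υ + d i j ξ υ) →
            (∫⁻ x : Fin n → Ω, ∫⁻ y : Fin n → Ω,
                (∑ i, ∑ j, ENNReal.ofReal (|f i j (x i) (y j)| ^ p)) ^ (1/p)
                ∂Measure.pi (fun _ => μ) ∂Measure.pi (fun _ => μ))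
              ≤ normL1L1 μ a + normLpLp μ p b + normL1Lp μ p c + normL1Lp' μ p d)
          ∧
          ((∫⁻ x : Fin n → Ω, ∫⁻ y : Fin n → Ω,
                (∑ i, ∑ j, ENNReal.ofReal (|f i j (x i) (y j)| ^ p)) ^ (1/p)
                ∂Measure.pi (fun _ => μ) ∂Measure.pi (fun _ => μ)) ≤ 1 →
            ∃ a b c d : Fin n → Fin n → Ω → Ω → ℝ,
              (∀ i j, Measurable (Function.uncurry (a i j))) ∧
              (∀ i j, Measurable (Function.uncurry (b i j))) ∧
              (∀ i j, Measurable (Function.uncurry (c i j))) ∧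
              (∀ i j, Measurable (Function.uncurry (d i j))) ∧
              (∀ i j ξ υ, f i j ξ υ = a i j ξ υ + b i j ξ υ + c i j ξ υ + d i j ξ υ) ∧
              (∀ i j ξ υ, [a i j ξ υ, b i j ξ υ, c i j ξ υ, d i j ξ υ].Pairwise
                fun u v => u = 0 ∨ v = 0) ∧
              normL1L1 μ a ≤ C ∧ normLpLp μ p b ≤ C ∧
              normL1Lp μ p c ≤ C ∧ normL1Lp' μ p d ≤ C)) := by
  refine ⟨12288, by norm_num, by simp, ?_⟩
  intro Ω _ μ _ n p hp f hf
  have hp0 : 0 < p := by linarith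
  have conv : ∀ r : ℝ, ENNReal.ofReal (|r| ^ p) = ENNReal.ofReal |r| ^ p := fun r =>
    (ENNReal.ofReal_rpow_of_nonneg (abs_nonneg r) hp0.le).symm
  have meas : ∀ a : Fin n → Fin n → Ω → Ω → ℝ, (∀ i j, Measurable (Function.uncurry (a i j))) →
      ∀ i j, Measurable (fun q : Ω × Ω => ENNReal.ofReal |a i j q.1 q.2|) := by
    intro a ha i j
    have h1 : Measurable (fun q : Ω × Ω => a i j q.1 q.2) := ha i j
    exact (h1.abs).ennreal_ofReal
  refine ⟨?_, ?_⟩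
  · intro a b c d ha hb hc hd h
    unfold normL1L1 normLpLp normL1Lp normL1Lp'
    simp only [conv]
    refine fsd_upper μ (fun i j q => ENNReal.ofReal |f i j q.1 q.2|)
      (fun i j q => ENNReal.ofReal |a i j q.1 q.2|) (fun i j q => ENNReal.ofReal |b i j q.1 q.2|)
      (fun i j q => ENNReal.ofReal |c i j q.1 q.2|) (fun i j q => ENNReal.ofReal |d i j q.1 q.2|)
      (meas a ha) (meas b hb) (meas c hc) (meas d hd) p hp ?_
    intro i j q
    rw [← ENNReal.ofReal_add (by positivity) (by positivity),
      ← ENNReal.ofReal_add (by positivity) (by positivity),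
      ← ENNReal.ofReal_add (by positivity) (by positivity)]
    refine ENNReal.ofReal_le_ofReal ?_
    rw [h]
    refine (abs_add_le _ _).trans (add_le_add_left ?_ _)
    refine (abs_add_le _ _).trans (add_le_add_left ?_ _)
    exact abs_add_le _ _
  · intro hF
    simp only [conv] at hF
    obtain ⟨SA, SB, SC, SD, mA, mB, mC, mD, hpart, bA, bB, bC, bD⟩ :=
      fsd_lower μ (fun i j q => ENNReal.ofReal |f i j q.1 q.2|) (meas f hf) p hp hF
    have cv1 : ∀ (S : Set (Ω × Ω)) i j ξ υ,
        ENNReal.ofReal |S.indicator (Function.uncurry (f i j)) (ξ, υ)| =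
        S.indicator (fun q : Ω × Ω => ENNReal.ofReal |f i j q.1 q.2|) (ξ, υ) := by
      intro S i j ξ υ
      by_cases h : (ξ, υ) ∈ S <;> simp [h]
    have cv2 : ∀ (S : Set (Ω × Ω)) i j ξ υ,
        ENNReal.ofReal |S.indicator (Function.uncurry (f i j)) (ξ, υ)| ^ p =
        S.indicator (fun q : Ω × Ω => ENNReal.ofReal |f i j q.1 q.2| ^ p) (ξ, υ) := by
      intro S i j ξ υ
      by_cases h : (ξ, υ) ∈ S <;> simp [h, hp0]
    have big : ∀ m : ℝ≥0∞, m ≤ 256 → m ≤ 12288 := fun m hm => hm.trans (by norm_num)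
    refine ⟨fun i j ξ υ => (SA i j).indicator (Function.uncurry (f i j)) (ξ, υ),
      fun i j ξ υ => (SB i j).indicator (Function.uncurry (f i j)) (ξ, υ),
      fun i j ξ υ => (SC i j).indicator (Function.uncurry (f i j)) (ξ, υ),
      fun i j ξ υ => (SD i j).indicator (Function.uncurry (f i j)) (ξ, υ),
      fun i j => (hf i j).indicator (mA i j), fun i j => (hf i j).indicator (mB i j),
      fun i j => (hf i j).indicator (mC i j), fun i j => (hf i j).indicator (mD i j),
      ?_, ?_, ?_, ?_, ?_, ?_⟩
    · intro i j ξ υ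
      rcases hpart i j (ξ, υ) with h | h | h | h <;> obtain ⟨h1, h2, h3, h4⟩ := h <;>
        simp [h1, h2, h3, h4]
    · intro i j ξ υ
      rcases hpart i j (ξ, υ) with h | h | h | h <;> obtain ⟨h1, h2, h3, h4⟩ := h <;>
        simp [h1, h2, h3, h4]
    · unfold normL1L1
      simp only [cv1]
      exact bA.trans (by norm_num)
    · unfold normLpLp
      simp only [conv, cv2]
      exact bB
    · unfold normL1Lp
      simp only [conv, cv2]
      exact big _ bC
    · unfold normL1Lp'
      simp only [conv, cv2]
      exact big _ bD
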